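/- R(K₄, J₈) ≥ 52. Equivalently: there exists a simple graph on 51 vertices containing no clique of size 4, whose complement contains no subgraph isomorphic to J₈. -/

import Mathlib

/-- `H` is contained in `G` as a (not necessarily induced) subgraph:
there is an injective map of vertices carrying edges of `H` to edges of `G`. -/
def containsCopy {α β : Type*} (H : SimpleGraph α) (G : SimpleGraph β) : Prop :=
  ∃ f : α ↪ β, ∀ ⦃a b : α⦄, H.Adj a b → G.Adj (f a) (f b)

/-- `J k` is the graph `K_k − e`: the complete graph on `k` vertices
with the edge between vertices `0` and `1` removed. -/
def J (k : ℕ) : SimpleGraph (Fin k) :=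
  SimpleGraph.fromRel fun a b => ¬(a.val = 0 ∧ b.val = 1) ∧ ¬(a.val = 1 ∧ b.val = 0)

/-- Backtracking search for cliques: `cliqueFreeIn G k L` is `true` if no `k` members of `L` are
pairwise adjacent in `G`. -/
def cliqueFreeIn {V : Type*} (G : SimpleGraph V) [DecidableRel G.Adj] : ℕ → List V → Bool
  | 0, _ => false
  | k + 1, L => L.rec true fun x t ih => cliqueFreeIn G k (t.filter (G.Adj x)) && ih

theorem card_ne_of_cliqueFreeIn {V : Type*} {G : SimpleGraph V} [DecidableRel G.Adj] {k : ℕ}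
    {L : List V} (h : cliqueFreeIn G k L = true) {S : Finset V} (hS : ∀ x ∈ S, x ∈ L)
    (hG : G.IsClique (S : Set V)) : S.card ≠ k := by
  classical
  induction k generalizing L S with
  | zero => simp [cliqueFreeIn] at h
  | succ k ih =>
    induction L with
    | nil =>
      have : S = ∅ := Finset.eq_empty_of_forall_notMem fun x hx => by simpa using hS x hx
      simp [this]
    | cons x t iht =>
      obtain ⟨hx, ht⟩ := (Bool.and_eq_true _ _).mp h
      by_cases hxS : x ∈ S
      · have key := ih (S := S.erase x) hx (fun y hy => ?_)
          (hG.subset (by simp))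
        · rw [Finset.card_erase_of_mem hxS] at key
          omega
        · obtain ⟨hyx, hy⟩ := Finset.mem_erase.1 hy
          exact List.mem_filter.2 ⟨(List.mem_cons.1 (hS y hy)).resolve_left hyx,
            decide_eq_true (hG hxS hy hyx.symm)⟩
      · exact iht ht fun y hy =>
          (List.mem_cons.1 (hS y hy)).resolve_left fun e => hxS (e ▸ hy)

/-- The connection sets of `blockGraph`, as bit masks: bit `d` of `connection i j` says whether
position `p` of block `i` is adjacent to position `p + d` modulo 17 of block `j`. -/
def connection : ℕ → ℕ → ℕ
  | 0, 0 => 33540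
  | 1, 1 => 73746
  | 2, 2 => 23784
  | 0, 1 | 1, 0 => 23785
  | 0, 2 | 2, 0 => 73747
  | _, _ => 33541

/-- A graph on 51 vertices whose adjacency matrix consists of nine circulant blocks of
size 17. -/
def blockGraph : SimpleGraph (Fin 51) where
  Adj a b := (connection (a / 17) (b / 17)).testBit ((b + 51 - a) % 17) = true
  symm := ⟨by decide +kernel⟩
  loopless := ⟨by decide +kernel⟩

instance : DecidableRel blockGraph.Adj := fun _ _ => inferInstanceAs (Decidable (_ = true))

theorem blockGraph_cliqueFree : blockGraph.CliqueFree 4 := by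
  have h : cliqueFreeIn blockGraph 4 (List.finRange 51) = true := by decide +kernel
  exact fun S hS =>
    card_ne_of_cliqueFreeIn h (fun x _ => List.mem_finRange x) hS.isClique hS.card_eq

/-- The automorphism of `blockGraph` shifting each block cyclically by 1. -/
def shift (v : Fin 51) : Fin 51 :=
  Fin.ofNat 51 (17 * (v / 17) + (v % 17 + 1) % 17)

/-- The automorphism of `blockGraph` doubling positions modulo 17 and exchanging the first two
blocks. -/
def doubleSwap (v : Fin 51) : Fin 51 :=
  Fin.ofNat 51 (17 * (if v.val < 34 then 1 - v / 17 else 2) + 2 * (v % 17) % 17)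

theorem blockGraph_compl_adj_shift :
    ∀ a b, blockGraphᶜ.Adj a b → blockGraphᶜ.Adj (shift a) (shift b) := by
  decide +kernel

theorem blockGraph_compl_adj_doubleSwap :
    ∀ a b, blockGraphᶜ.Adj a b → blockGraphᶜ.Adj (doubleSwap a) (doubleSwap b) := by
  decide +kernel

theorem shift_injective : Function.Injective shift := by
  unfold Function.Injective
  decide +kernel

theorem doubleSwap_injective : Function.Injective doubleSwap := by
  unfold Function.Injective
  decide +kernel

theorem exists_doubleSwap_iterate_shift_iterate_eq (a : Fin 51) :
    ∃ i : Fin 17, ∃ j : Fin 2, doubleSwap^[j] (shift^[i] a) = 0 ∨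
      doubleSwap^[j] (shift^[i] a) = 34 := by
  revert a
  decide +kernel

theorem exists_copy_apply_iterate {α V : Type*} {H : SimpleGraph α} {G : SimpleGraph V}
    {σ : V → V} (hσ : Function.Injective σ) (hadj : ∀ a b, G.Adj a b → G.Adj (σ a) (σ b)) (i : ℕ)
    {x : α} {a : V} (h : ∃ f : α ↪ V, (∀ ⦃x y⦄, H.Adj x y → G.Adj (f x) (f y)) ∧ f x = a) :
    ∃ f : α ↪ V, (∀ ⦃x y⦄, H.Adj x y → G.Adj (f x) (f y)) ∧ f x = σ^[i] a := by
  induction i generalizing a with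
  | zero => exact h
  | succ i ih =>
    obtain ⟨f, hf, rfl⟩ := h
    exact ih ⟨f.trans ⟨σ, hσ⟩, fun x y hxy => hadj _ _ (hf hxy), rfl⟩

theorem cliqueFreeIn_blockGraph_compl : ∀ a b : Fin 51, a = 0 ∨ a = 34 → a ≠ b →
    cliqueFreeIn blockGraphᶜ 6 ((List.finRange 51).filter fun x =>
      blockGraphᶜ.Adj a x ∧ blockGraphᶜ.Adj b x) = true := by
  decide +kernel

theorem J_adj_of_two_le {k : ℕ} {x y : Fin k} (hxy : x ≠ y) (hy : 2 ≤ y.val) :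
    (J k).Adj x y := by
  rw [J, SimpleGraph.fromRel_adj]
  exact ⟨hxy, Or.inl ⟨by omega, by omega⟩⟩

theorem blockGraph_not_containsCopy : ¬ containsCopy (J 8) blockGraphᶜ := by
  rintro ⟨f, hf⟩
  obtain ⟨i, j, hij⟩ := exists_doubleSwap_iterate_shift_iterate_eq (f 0)
  obtain ⟨g, hg, hg₀⟩ :=
    exists_copy_apply_iterate doubleSwap_injective blockGraph_compl_adj_doubleSwap j
      (exists_copy_apply_iterate shift_injective blockGraph_compl_adj_shift i ⟨f, hf, rfl⟩)
  rw [← hg₀] at hij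
  have h01 : g 0 ≠ g 1 := g.injective.ne (by decide)
  refine card_ne_of_cliqueFreeIn (cliqueFreeIn_blockGraph_compl _ _ hij h01)
    (S := (Finset.univ.filter fun x : Fin 8 => 2 ≤ x.val).map g) ?_ ?_
    (by rw [Finset.card_map]; decide)
  · intro v hv
    obtain ⟨x, hx, rfl⟩ := Finset.mem_map.1 hv
    have hx : 2 ≤ x.val := (Finset.mem_filter.1 hx).2
    exact List.mem_filter.2 ⟨List.mem_finRange _, decide_eq_true
      ⟨hg (J_adj_of_two_le (by rintro rfl; simp at hx) hx),
        hg (J_adj_of_two_le (by rintro rfl; simp at hx) hx)⟩⟩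
  · intro v hv w hw hne
    obtain ⟨x, -, rfl⟩ := Finset.mem_map.1 hv
    obtain ⟨y, hy, rfl⟩ := Finset.mem_map.1 hw
    exact hg (J_adj_of_two_le (fun e => hne (congrArg _ e)) (Finset.mem_filter.1 hy).2)

/-- R(K₄, J₈) ≥ 52: there is a graph on 51 vertices with no clique of size 4
whose complement contains no subgraph isomorphic to `J 8`. -/
theorem ramsey_K4_J8_ge_52 :
    ∃ G : SimpleGraph (Fin 51), G.CliqueFree 4 ∧ ¬ containsCopy (J 8) Gᶜ := by
  exact ⟨blockGraph, blockGraph_cliqueFree, blockGraph_not_containsCopy⟩
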